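/- Let r : [0,∞) → [0,∞) be a 0-rough contraction and 0 < ε < 1. Define r' : [0,∞) → [0,∞) by r'(t) := r(t) if r(t) < 1 and r'(t) := r(t)^ε if r(t) ≥ 1. Then r' is a 0-rough contraction, r'(t) ≤ r(t) for all t, and for all t,t' ≥ 0 with r(t^ε) ≥ 1 and r(t'^ε) ≥ 1 one has |r'(t^ε)^{1/ε} − r'(t'^ε)^{1/ε}| ≤ |t − t'|. -/

import Mathlib

/-- A τ-rough contraction `σ : [0,∞) → [0,∞)`. -/
def RoughContraction (τ : ℝ) (σ : ℝ → ℝ) : Prop :=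
  σ 0 = 0 ∧ Filter.Tendsto σ Filter.atTop Filter.atTop ∧
  (∀ t, 0 ≤ t → 0 ≤ σ t) ∧ (∀ t, 0 ≤ t → σ t ≤ t) ∧
  (∀ s t, 0 ≤ s → 0 ≤ t → |σ t - σ s| ≤ |t - s| + τ) ∧
  (∀ s t, 0 ≤ s → s ≤ t → σ s ≤ σ t)

theorem aux_pow (ε a b : ℝ) (h0 : 0 < ε) (h1 : ε < 1) (ha : 1 ≤ a) (hab : a ≤ b) :
    a ^ ε ≤ b ^ ε ∧ b ^ ε - a ^ ε ≤ b - a := by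
  have ha0 : 0 < a := by linarith
  refine ⟨Real.rpow_le_rpow ha0.le hab h0.le, ?_⟩
  have hu : 1 ≤ b / a := by rwa [le_div_iff₀ ha0, one_mul]
  have hb : b = a * (b / a) := by field_simp
  have e : b ^ ε = a ^ ε * (b / a) ^ ε := by
    rw [← Real.mul_rpow ha0.le (by linarith), ← hb]
  have h2 : (b / a) ^ ε ≤ b / a := by
    simpa using Real.rpow_le_rpow_of_exponent_le hu h1.le
  have h3 : a ^ ε ≤ a := by
    simpa using Real.rpow_le_rpow_of_exponent_le ha h1.le
  have h4 : 0 ≤ a ^ ε := Real.rpow_nonneg ha0.le _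
  rw [e]
  nlinarith [mul_le_mul_of_nonneg_left h2 h4, mul_le_mul_of_nonneg_right h3 (sub_nonneg.2 hu)]

theorem aux_f (ε x y : ℝ) (h0 : 0 < ε) (h1 : ε < 1) (hxy : x ≤ y) :
    (if x < 1 then x else x ^ ε) ≤ (if y < 1 then y else y ^ ε) ∧
    (if y < 1 then y else y ^ ε) - (if x < 1 then x else x ^ ε) ≤ y - x := by
  by_cases hx : x < 1
  · by_cases hy : y < 1
    · simp only [hx, hy, if_true]
      exact ⟨hxy, le_rfl⟩
    · simp only [hx, hy, if_true, if_false]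
      have := aux_pow ε 1 y h0 h1 le_rfl (not_lt.1 hy)
      rw [Real.one_rpow] at this
      constructor <;> linarith [this.1, this.2]
  · have hy : ¬ y < 1 := by linarith
    simp only [hx, hy, if_false]
    exact aux_pow ε x y h0 h1 (not_lt.1 hx) hxy

theorem stmt_3 (r : ℝ → ℝ) (hr : RoughContraction 0 r)
    (ε : ℝ) (hε0 : 0 < ε) (hε1 : ε < 1)
    (r' : ℝ → ℝ) (hr' : ∀ t, r' t = if r t < 1 then r t else (r t) ^ ε) :
    RoughContraction 0 r' ∧ (∀ t, 0 ≤ t → r' t ≤ r t) ∧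
    (∀ t t' : ℝ, 0 ≤ t → 0 ≤ t' → 1 ≤ r (t ^ ε) → 1 ≤ r (t' ^ ε) →
      |r' (t ^ ε) ^ (1/ε) - r' (t' ^ ε) ^ (1/ε)| ≤ |t - t'|) := by
  obtain ⟨hz, hT, hn, hle, hL, hm⟩ := hr
  have hle' : ∀ t, 0 ≤ t → r' t ≤ r t := by
    intro t ht
    have := (aux_f ε 0 (r t) hε0 hε1 (hn t ht)).2
    rw [← hr' t] at this
    simpa using this
  refine ⟨⟨by simp [hr', hz], ?_, ?_, fun t ht => (hle' t ht).trans (hle t ht), ?_, ?_⟩, hle', ?_⟩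
  · refine ((tendsto_rpow_atTop hε0).comp hT).congr' ?_
    filter_upwards [hT.eventually_ge_atTop 1] with t ht
    simp [hr', not_lt.2 ht]
  · intro t ht
    have := (aux_f ε 0 (r t) hε0 hε1 (hn t ht)).1
    rw [← hr' t] at this
    simpa using this
  · have key : ∀ s t, 0 ≤ s → s ≤ t → |r' t - r' s| ≤ |t - s| + 0 := by
      intro s t hs hst
      have h := aux_f ε (r s) (r t) hε0 hε1 (hm s t hs hst)
      rw [← hr' t, ← hr' s] at h
      refine le_trans ?_ (hL s t hs (hs.trans hst))
      rw [abs_of_nonneg (sub_nonneg.2 h.1)]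
      exact h.2.trans (le_abs_self _)
    intro s t hs ht
    rcases le_total s t with h | h
    · exact key s t hs h
    · rw [abs_sub_comm (r' t), abs_sub_comm t]
      exact key t s ht h
  · intro s t hs hst
    rw [hr' s, hr' t]
    exact (aux_f ε (r s) (r t) hε0 hε1 (hm s t hs hst)).1
  · have red : ∀ t, 1 ≤ r (t ^ ε) → r' (t ^ ε) ^ (1/ε) = r (t ^ ε) := by
      intro t h
      rw [hr', if_neg (not_lt.2 h), ← Real.rpow_mul (by linarith), mul_one_div_cancel hε0.ne',
        Real.rpow_one]
    have one : ∀ t, 0 ≤ t → 1 ≤ r (t ^ ε) → 1 ≤ t := by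
      intro t ht h
      by_contra hc
      have h2 := hle _ (Real.rpow_nonneg ht ε)
      have h3 := Real.rpow_lt_one ht (not_le.1 hc) hε0
      linarith
    intro t t' ht ht' h h'
    rw [red t h, red t' h']
    have h1 := hL _ _ (Real.rpow_nonneg ht' ε) (Real.rpow_nonneg ht ε)
    rw [add_zero] at h1
    refine h1.trans ?_
    rcases le_total t t' with g | g
    · have := aux_pow ε t t' hε0 hε1 (one t ht h) g
      rw [abs_sub_comm, abs_sub_comm t, abs_of_nonneg (sub_nonneg.2 this.1)]
      exact this.2.trans (le_abs_self _)
    · have := aux_pow ε t' t hε0 hε1 (one t' ht' h') g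
      rw [abs_of_nonneg (sub_nonneg.2 this.1)]
      exact this.2.trans (le_abs_self _)
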